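/- arXiv:2512.18008 — 2 statements merged into one kernel-verified Lean document; each statement's English description precedes it below -/
import Mathlib

section
/- As r → 0 within (0, ∞), the irrotational profile has the quadratic expansion g(r) = (σ²/(3·cosh(σρ)²))·r² + O(r⁴); precisely, the function r ↦ g(r) − (σ²/(3·cosh(σρ)²))·r² is big-O of r⁴ along the filter of positive reals tending to 0. -/
open Asymptotics

noncomputable def Fanti (σ ρ r : ℝ) : ℝ :=
  (2 * r * σ * Real.sinh (σ * ρ) +
    Real.cosh (σ * ρ) *
      (Real.log (Real.cosh (σ * (r - ρ))) - Real.log (Real.cosh (σ * (r + ρ))))) /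
  (2 * σ * Real.sinh (σ * ρ))

theorem sinh_sq_bounds {x : ℝ} (hx0 : 0 ≤ x) (hx1 : x ≤ 1) :
    x ^ 2 ≤ Real.sinh x ^ 2 ∧ Real.sinh x ^ 2 ≤ x ^ 2 + x ^ 4 := by
  refine ⟨pow_le_pow_left₀ hx0 (Real.self_le_sinh_iff.2 hx0) 2, ?_⟩
  have hcosh : Real.cosh x ^ 2 ≤ Real.exp (x ^ 2) := by
    calc Real.cosh x ^ 2 ≤ Real.exp (x ^ 2 / 2) ^ 2 :=
          pow_le_pow_left₀ (Real.cosh_pos x).le (Real.cosh_le_exp_half_sq x) 2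
      _ = Real.exp (x ^ 2) := by rw [← Real.exp_nat_mul]; congr 1; push_cast; ring
  have habs : |x ^ 2| ≤ 1 := by rw [abs_of_nonneg (sq_nonneg x)]; nlinarith
  have hexp := (abs_le.1 (Real.abs_exp_sub_one_sub_id_le habs)).2
  nlinarith [Real.cosh_sq x]

theorem abs_div_add_sub_div_le {c x S : ℝ} (hc : 1 ≤ c) (hx : x ^ 2 ≤ 1)
    (hS : x ^ 2 ≤ S) (hS' : S ≤ x ^ 2 + x ^ 4) :
    |S / (S + c) - x ^ 2 / c| ≤ 2 * x ^ 4 := by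
  have hx2 := sq_nonneg x
  have hS0 : 0 ≤ S := hx2.trans hS
  have hx4 : 0 ≤ x ^ 4 := by positivity
  have hdenom : 1 ≤ (S + c) * c := by nlinarith
  have hxS : x ^ 2 * S ≤ 2 * x ^ 4 := by nlinarith
  have hnum : |c * (S - x ^ 2) - x ^ 2 * S| ≤ 2 * x ^ 4 * c := by
    rw [abs_le]
    constructor <;> nlinarith [mul_nonneg hx2 hS0, mul_nonneg hx4 (sub_nonneg.2 hc)]
  have heq : S / (S + c) - x ^ 2 / c = (c * (S - x ^ 2) - x ^ 2 * S) / ((S + c) * c) := by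
    have : S + c ≠ 0 := by positivity
    field_simp
    ring
  rw [heq, abs_div, abs_of_pos (by linarith : 0 < (S + c) * c), div_le_iff₀ (by linarith)]
  refine hnum.trans (mul_le_mul_of_nonneg_left ?_ (by positivity))
  nlinarith

theorem hasDerivAt_Fanti {σ ρ : ℝ} (hσ : 0 < σ) (hρ : 0 < ρ) (r : ℝ) :
    HasDerivAt (Fanti σ ρ)
      (Real.sinh (σ * r) ^ 2 / (Real.sinh (σ * r) ^ 2 + Real.cosh (σ * ρ) ^ 2)) r := by
  have hsinh : 0 < Real.sinh (σ * ρ) := Real.sinh_pos_iff.2 (by positivity)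
  have hm := ((((hasDerivAt_id r).sub_const ρ).const_mul σ).cosh).log (Real.cosh_pos _).ne'
  have hp := ((((hasDerivAt_id r).add_const ρ).const_mul σ).cosh).log (Real.cosh_pos _).ne'
  have hl := (((hasDerivAt_id r).const_mul 2).mul_const σ).mul_const (Real.sinh (σ * ρ))
  have h := (hl.add ((hm.sub hp).const_mul (Real.cosh (σ * ρ)))).div_const
    (2 * σ * Real.sinh (σ * ρ))
  refine h.congr_deriv ?_
  simp only [id]
  have hcm := Real.cosh_pos (σ * (r - ρ))
  have hcp := Real.cosh_pos (σ * (r + ρ))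
  have hprod : Real.cosh (σ * (r - ρ)) * Real.cosh (σ * (r + ρ)) =
      Real.sinh (σ * r) ^ 2 + Real.cosh (σ * ρ) ^ 2 := by
    rw [mul_sub, mul_add, Real.cosh_sub, Real.cosh_add]
    linear_combination Real.cosh (σ * ρ) ^ 2 * Real.cosh_sq (σ * r) +
      Real.sinh (σ * r) ^ 2 * Real.cosh_sq (σ * ρ)
  have hdiff : Real.sinh (σ * (r - ρ)) * Real.cosh (σ * (r + ρ)) -
      Real.sinh (σ * (r + ρ)) * Real.cosh (σ * (r - ρ)) =
      -2 * Real.sinh (σ * ρ) * Real.cosh (σ * ρ) := by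
    rw [mul_sub, mul_add, Real.cosh_sub, Real.cosh_add, Real.sinh_sub, Real.sinh_add]
    linear_combination -2 * Real.sinh (σ * ρ) * Real.cosh (σ * ρ) * Real.cosh_sq (σ * r)
  rw [← hprod]
  field_simp
  linear_combination Real.cosh (σ * ρ) * hdiff + 2 * Real.sinh (σ * ρ) * hprod

theorem abs_Fanti_sub_cubic_le {σ ρ r : ℝ} (hσ : 0 < σ) (hρ : 0 < ρ) (hr : 0 ≤ r)
    (hr' : σ * r ≤ 1) :
    |Fanti σ ρ r - σ ^ 2 / (3 * Real.cosh (σ * ρ) ^ 2) * r ^ 3| ≤ 2 * σ ^ 4 * r ^ 5 := by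
  have hcosh : 1 ≤ Real.cosh (σ * ρ) ^ 2 := one_le_pow₀ (Real.one_le_cosh _)
  have hderiv (t : ℝ) : HasDerivAt
      (fun t => Fanti σ ρ t - σ ^ 2 / (3 * Real.cosh (σ * ρ) ^ 2) * t ^ 3)
      (Real.sinh (σ * t) ^ 2 / (Real.sinh (σ * t) ^ 2 + Real.cosh (σ * ρ) ^ 2) -
        (σ * t) ^ 2 / Real.cosh (σ * ρ) ^ 2) t := by
    refine ((hasDerivAt_Fanti hσ hρ t).sub ((hasDerivAt_pow 3 t).const_mul _)).congr_deriv ?_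
    have := Real.cosh_pos (σ * ρ)
    field_simp
    ring
  have hbound : ∀ t ∈ Set.Icc 0 r,
      ‖Real.sinh (σ * t) ^ 2 / (Real.sinh (σ * t) ^ 2 + Real.cosh (σ * ρ) ^ 2) -
        (σ * t) ^ 2 / Real.cosh (σ * ρ) ^ 2‖ ≤ 2 * (σ * r) ^ 4 := by
    rintro t ⟨ht0, htr⟩
    have hσt : 0 ≤ σ * t := by positivity
    have hσtr : σ * t ≤ σ * r := by gcongr
    obtain ⟨hl, hu⟩ := sinh_sq_bounds hσt (hσtr.trans hr')
    refine (abs_div_add_sub_div_le hcosh (pow_le_one₀ hσt (hσtr.trans hr')) hl hu).trans ?_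
    gcongr
  have hmvt := (convex_Icc 0 r).norm_image_sub_le_of_norm_hasDerivWithin_le
    (fun t _ => (hderiv t).hasDerivWithinAt) hbound
    (Set.left_mem_Icc.2 hr) (Set.right_mem_Icc.2 hr)
  have hzero : Fanti σ ρ 0 = 0 := by simp [Fanti]
  rw [hzero, sub_zero r, Real.norm_eq_abs, Real.norm_eq_abs, abs_of_nonneg hr] at hmvt
  convert hmvt using 1
  · congr 1
    ring
  · ring

theorem g_quadratic_expansion (σ ρ : ℝ) (hσ : 0 < σ) (hρ : 0 < ρ) :
    (fun r : ℝ => Fanti σ ρ r / r - (σ ^ 2 / (3 * (Real.cosh (σ * ρ)) ^ 2)) * r ^ 2)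
      =O[nhdsWithin 0 (Set.Ioi 0)] (fun r : ℝ => r ^ 4) := by
  refine IsBigO.of_bound (2 * σ ^ 4) ?_
  filter_upwards [Ioc_mem_nhdsGT (one_div_pos.2 hσ)] with r ⟨hr0, hr1⟩
  have hr : σ * r ≤ 1 := by rwa [le_div_iff₀' hσ] at hr1
  have heq : Fanti σ ρ r / r - σ ^ 2 / (3 * Real.cosh (σ * ρ) ^ 2) * r ^ 2 =
      (Fanti σ ρ r - σ ^ 2 / (3 * Real.cosh (σ * ρ) ^ 2) * r ^ 3) / r := by
    rw [sub_div, mul_div_assoc, show r ^ 3 / r = r ^ 2 by field_simp]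
  rw [heq, norm_div, Real.norm_of_nonneg hr0.le, Real.norm_of_nonneg (by positivity : 0 ≤ r ^ 4),
    div_le_iff₀ hr0]
  calc _ ≤ 2 * σ ^ 4 * r ^ 5 := abs_Fanti_sub_cubic_le hσ hρ hr0.le hr
    _ = 2 * σ ^ 4 * r ^ 4 * r := by ring
end

section
/- Let h : ℝ → ℝ be differentiable on (0, ∞) and satisfy the irrotationality ODE r·h′(r) + h(r) = 1 − f_Alc(r) for all r > 0, together with the regularity boundary condition h(r) → 0 as r → 0 from the right. Then h(r) = g(r) = F(r)/r for all r > 0; i.e. the closed-form irrotational profile is the unique regular solution of the irrotationality ODE. -/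
noncomputable def fAlc (σ ρ r : ℝ) : ℝ :=
  (Real.tanh (σ * (r + ρ)) - Real.tanh (σ * (r - ρ))) / (2 * Real.tanh (σ * ρ))

theorem hasDerivAt_log_cosh_mul_add (σ a r : ℝ) :
    HasDerivAt (fun x => Real.log (Real.cosh (σ * (x + a)))) (σ * Real.tanh (σ * (r + a))) r := by
  have hlin : HasDerivAt (fun x : ℝ => σ * (x + a)) (σ * 1) r :=
    ((hasDerivAt_id r).add_const a).const_mul σ
  convert hlin.cosh.log (Real.cosh_pos _).ne' using 1
  rw [Real.tanh_eq_sinh_div_cosh]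
  ring

theorem hasDerivAt_Fanti_s12 {σ ρ : ℝ} (hσ : 0 < σ) (hρ : 0 < ρ) (r : ℝ) :
    HasDerivAt (Fanti σ ρ) (1 - fAlc σ ρ r) r := by
  have hs : Real.sinh (σ * ρ) ≠ 0 := (Real.sinh_pos_iff.mpr (mul_pos hσ hρ)).ne'
  have hc : Real.cosh (σ * ρ) ≠ 0 := (Real.cosh_pos _).ne'
  have hlin : HasDerivAt (fun x : ℝ => 2 * x * σ * Real.sinh (σ * ρ))
      (2 * 1 * σ * Real.sinh (σ * ρ)) r :=
    (((hasDerivAt_id r).const_mul 2).mul_const σ).mul_const _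
  have hlog := ((hasDerivAt_log_cosh_mul_add σ (-ρ) r).sub
    (hasDerivAt_log_cosh_mul_add σ ρ r)).const_mul (Real.cosh (σ * ρ))
  simp only [← sub_eq_add_neg] at hlog
  refine ((hlin.add hlog).div_const (2 * σ * Real.sinh (σ * ρ))).congr_deriv ?_
  rw [fAlc, Real.tanh_eq_sinh_div_cosh (σ * ρ)]
  field_simp
  ring

theorem Fanti_zero (σ ρ : ℝ) : Fanti σ ρ 0 = 0 := by
  simp [Fanti]

theorem unique_regular_solution (σ ρ : ℝ) (hσ : 0 < σ) (hρ : 0 < ρ)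
    (h : ℝ → ℝ) (hdiff : DifferentiableOn ℝ h (Set.Ioi 0))
    (hode : ∀ r : ℝ, 0 < r → r * deriv h r + h r = 1 - fAlc σ ρ r)
    (hbc : Filter.Tendsto h (nhdsWithin 0 (Set.Ioi 0)) (nhds 0)) :
    ∀ r : ℝ, 0 < r → h r = Fanti σ ρ r / r := by
  have hderiv : ∀ x ∈ Set.Ioi (0 : ℝ), HasDerivAt (fun x => x * h x - Fanti σ ρ x) 0 x := by
    intro x hx
    have hh := (hdiff.differentiableAt (Ioi_mem_nhds hx)).hasDerivAt
    refine (((hasDerivAt_id x).mul hh).sub (hasDerivAt_Fanti_s12 hσ hρ x)).congr_deriv ?_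
    simp only [id]
    linarith [hode x hx]
  have hlim : Filter.Tendsto (fun x => x * h x - Fanti σ ρ x)
      (nhdsWithin 0 (Set.Ioi 0)) (nhds 0) := by
    have hid : Filter.Tendsto (fun x : ℝ => x) (nhdsWithin 0 (Set.Ioi 0)) (nhds 0) :=
      nhdsWithin_le_nhds
    have hF := (hasDerivAt_Fanti_s12 hσ hρ 0).continuousAt.tendsto.mono_left
      (nhdsWithin_le_nhds (s := Set.Ioi 0))
    rw [Fanti_zero] at hF
    simpa using (hid.mul hbc).sub hF
  intro r hr
  have hconst : ∀ x ∈ Set.Ioi (0 : ℝ), x * h x - Fanti σ ρ x = r * h r - Fanti σ ρ r :=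
    fun x hx => isOpen_Ioi.is_const_of_deriv_eq_zero isPreconnected_Ioi
      (fun y hy => (hderiv y hy).differentiableAt.differentiableWithinAt)
      (fun y hy => (hderiv y hy).deriv) hx hr
  have hzero : r * h r - Fanti σ ρ r = 0 :=
    tendsto_nhds_unique
      (tendsto_const_nhds.congr' (eventually_nhdsWithin_of_forall fun x hx => (hconst x hx).symm))
      hlim
  rw [eq_div_iff hr.ne']
  linarith
end
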